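/- arXiv:1602.08004 — 3 statements merged into one kernel-verified Lean document; each statement's English description precedes it below -/
import Mathlib

section
/- Let a : ℕ → {0,1} (indices starting at 1) and let x = Σ_{i=1}^∞ a(i)·10^{−i(i+1)/2}, i.e. the real number whose decimal expansion is 0.a(1) 0 a(2) 0 0 a(3) 0 0 0 a(4) ⋯, with i zeros between a(i) and a(i+1). Then x is rational if and only if a(i) = 0 for all but finitely many i. -/
theorem triangular_succ (n : ℕ) :
    (n + 1 + 1) * (n + 1 + 2) / 2 = (n + 1) * (n + 2) / 2 + (n + 2) := by
  rw [show (n + 1 + 1) * (n + 1 + 2) = (n + 1) * (n + 2) + (n + 2) * 2 by ring,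
    Nat.add_mul_div_right _ _ two_pos]

theorem triangular_add_le (n k : ℕ) :
    (n + 1) * (n + 2) / 2 + k ≤ (n + k + 1) * (n + k + 2) / 2 := by
  induction k with
  | zero => simp
  | succ k ih =>
    have h := triangular_succ (n + k)
    rw [← add_assoc n k 1]
    omega

/-- The terms of the expansion after index `n` are dominated by a geometric sequence. -/
theorem tail_term_le (a : ℕ → ℕ) (ha : ∀ i, a i ≤ 1) (n k : ℕ) :
    (a (k + (n + 1) + 1) : ℝ) / 10 ^ ((k + (n + 1) + 1) * (k + (n + 1) + 2) / 2) ≤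
      1 / 10 ^ ((n + 1) * (n + 2) / 2 + (n + 2)) * (1 / 10) ^ k := by
  have h := triangular_add_le (n + 1) k
  rw [triangular_succ, add_comm (n + 1) k] at h
  rw [one_div_pow, one_div_mul_one_div, ← pow_add]
  gcongr
  · exact_mod_cast ha _
  · norm_num

theorem summable_triangular_digits (a : ℕ → ℕ) (ha : ∀ i, a i ≤ 1) :
    Summable fun i : ℕ => (a (i + 1) : ℝ) / 10 ^ ((i + 1) * (i + 2) / 2) := by
  rw [← summable_nat_add_iff 1]
  exact Summable.of_nonneg_of_le (fun k => by positivity)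
    (fun k => tail_term_le a ha 0 k)
    ((summable_geometric_of_lt_one (by norm_num) (by norm_num)).mul_left _)

theorem tail_le (a : ℕ → ℕ) (ha : ∀ i, a i ≤ 1) (n : ℕ) :
    ∑' k : ℕ, (a (k + (n + 1) + 1) : ℝ) / 10 ^ ((k + (n + 1) + 1) * (k + (n + 1) + 2) / 2) ≤
      1 / 10 ^ ((n + 1) * (n + 2) / 2 + (n + 2)) * (10 / 9) := by
  have hg : HasSum (fun k : ℕ => (1 / 10 : ℝ) ^ k) (10 / 9) := by
    convert hasSum_geometric_of_lt_one (r := (1 / 10 : ℝ)) (by norm_num) (by norm_num) using 1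
    norm_num
  exact hasSum_le (tail_term_le a ha n)
    ((summable_nat_add_iff (n + 1)).2 (summable_triangular_digits a ha)).hasSum (hg.mul_left _)

theorem exists_nat_eq_scaled_partial_sum (a : ℕ → ℕ) (n : ℕ) :
    ∃ m : ℕ, (m : ℝ) = 10 ^ ((n + 1) * (n + 2) / 2) *
      ∑ i ∈ Finset.range (n + 1), (a (i + 1) : ℝ) / 10 ^ ((i + 1) * (i + 2) / 2) := by
  refine ⟨∑ i ∈ Finset.range (n + 1),
    a (i + 1) * 10 ^ ((n + 1) * (n + 2) / 2 - (i + 1) * (i + 2) / 2), ?_⟩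
  rw [Finset.mul_sum]
  push_cast
  refine Finset.sum_congr rfl fun i hi => ?_
  have hin : i ≤ n := Nat.lt_succ_iff.1 (Finset.mem_range.1 hi)
  have hle : (i + 1) * (i + 2) / 2 ≤ (n + 1) * (n + 2) / 2 := by gcongr
  rw [pow_sub₀ _ (by norm_num) hle]
  ring

/-- Let x be the real number with decimal expansion 0.a(1) 0 a(2) 0 0 a(3) 0 0 0 a(4) ⋯,
where a : ℕ → {0,1} (so the digit a(i) sits at decimal position i(i+1)/2). Then x is
rational if and only if a(i) = 0 for all but finitely many i. -/
theorem rational_iff_finitely_many_ones (a : ℕ → ℕ) (ha : ∀ i, a i ≤ 1) :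
    (∃ q : ℚ, (q : ℝ) = ∑' i : ℕ, (a (i + 1) : ℝ) / 10 ^ ((i + 1) * (i + 2) / 2)) ↔
      {i : ℕ | a i ≠ 0}.Finite := by
  constructor
  · rintro ⟨q, hq⟩
    by_contra hinf
    have hs := summable_triangular_digits a ha
    set n := q.den with hn
    obtain ⟨m, hm⟩ := exists_nat_eq_scaled_partial_sum a n
    have hle := tail_le a ha n
    have hpos : 0 < ∑' k : ℕ,
        (a (k + (n + 1) + 1) : ℝ) / 10 ^ ((k + (n + 1) + 1) * (k + (n + 1) + 2) / 2) := by
      obtain ⟨j, hj, hnj⟩ := Set.Infinite.exists_gt hinf (n + 1)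
      obtain ⟨k, rfl⟩ := Nat.exists_eq_add_of_lt hnj
      refine ((summable_nat_add_iff (n + 1)).2 hs).tsum_pos (fun k => by positivity) k ?_
      have hak : 0 < a (k + (n + 1) + 1) := by
        rw [add_comm k]
        exact Nat.pos_of_ne_zero hj
      positivity
    rw [← hs.sum_add_tsum_nat_add (n + 1)] at hq
    set t := ∑' k : ℕ,
      (a (k + (n + 1) + 1) : ℝ) / 10 ^ ((k + (n + 1) + 1) * (k + (n + 1) + 2) / 2)
    set P : ℝ := 10 ^ ((n + 1) * (n + 2) / 2) with hP
    have hP0 : 0 < P := by positivity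
    have hn0 : (0 : ℝ) < n := by exact_mod_cast q.den_pos
    have hqn : (n : ℝ) * q = q.num := by exact_mod_cast Rat.den_mul_eq_num q
    have hint : ((10 ^ ((n + 1) * (n + 2) / 2) * q.num - n * m : ℤ) : ℝ) = n * (P * t) := by
      push_cast
      rw [← hP, ← hqn, hq, hm]
      ring
    have hlt : n * (P * t) < 1 := by
      have hpow : (n : ℝ) < 10 ^ n := by exact_mod_cast Nat.lt_pow_self (by norm_num)
      calc n * (P * t) ≤ n * (P * (1 / (P * 10 ^ (n + 2)) * (10 / 9))) := by
            rw [pow_add, ← hP] at hle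
            gcongr
        _ = n / 10 ^ n * (1 / 90) := by
            field_simp
            ring
        _ < 1 := by
            have := (div_lt_one (by positivity)).2 hpow
            linarith
    have hgt : 0 < n * (P * t) := by positivity
    rw [← hint] at hlt hgt
    have h₁ := Int.cast_pos.1 hgt
    have h₂ : (10 ^ ((n + 1) * (n + 2) / 2) * q.num - n * m : ℤ) < 1 := by exact_mod_cast hlt
    omega
  · intro hfin
    obtain ⟨N, hN⟩ := hfin.bddAbove
    refine ⟨∑ i ∈ Finset.range N, (a (i + 1) : ℚ) / 10 ^ ((i + 1) * (i + 2) / 2), ?_⟩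
    rw [tsum_eq_sum (s := Finset.range N)]
    · push_cast
      rfl
    · intro i hi
      have h0 : a (i + 1) = 0 := by
        by_contra h
        exact hi (Finset.mem_range.2 (hN h))
      simp [h0]
end

section
/- Let n ≥ 1 and m, k ∈ ℕ, and let f : ℝ^m → ℝ^k. Suppose f admits an n-tower F : ℕ^n × ℝ^m → ℝ^k such that the section F(i₁,…,iₙ,·) : ℝ^m → ℝ^k is continuous for every (i₁,…,iₙ) ∈ ℕ^n. Then f admits an n-tower G : ℕ^n × ℝ^m → ℝ^k such that every coordinate of every section G(i₁,…,iₙ,·) is a polynomial function in m variables with rational coefficients. -/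
open Filter

/-- `IterLimit n F y` says that the iterated limits lim_{i₁→∞} ⋯ lim_{iₙ→∞} F(i₁,…,iₙ)
exist (innermost limit first, each intermediate limit required to exist) and equal y. -/
def IterLimit {E : Type*} [TopologicalSpace E] : (n : ℕ) → ((Fin n → ℕ) → E) → E → Prop
  | 0, F, y => F (fun i => i.elim0) = y
  | n + 1, F, y => ∃ g : ℕ → E,
      (∀ i : ℕ, IterLimit n (fun v => F (Fin.cons i v)) (g i)) ∧
      Tendsto g atTop (nhds y)

/-- If two families become arbitrarily close as the last index grows, then they have the same
iterated limits. -/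
theorem IterLimit.congr_dist {E : Type*} [PseudoMetricSpace E] {n : ℕ}
    {F G : (Fin (n + 1) → ℕ) → E} {y : E} (hF : IterLimit (n + 1) F y)
    (h : Tendsto (fun v => dist (F v) (G v))
      (comap (fun v : Fin (n + 1) → ℕ => v (Fin.last n)) atTop) (nhds 0)) :
    IterLimit (n + 1) G y := by
  induction n generalizing y with
  | zero =>
    obtain ⟨g, hg, hy⟩ := hF
    refine ⟨fun i => G (Fin.cons i fun j => j.elim0), fun i => rfl, ?_⟩
    refine tendsto_of_tendsto_of_dist hy ((h.comp (tendsto_comap_iff.2 ?_ :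
      Tendsto (fun i : ℕ => (Fin.cons i fun j => j.elim0 : Fin 1 → ℕ)) atTop _)).congr ?_)
    · exact tendsto_id
    · intro i
      rw [← hg i]
      rfl
  | succ n ih =>
    obtain ⟨g, hg, hy⟩ := hF
    refine ⟨g, fun i => ih (hg i) (h.comp (tendsto_comap_iff.2 ?_ :
      Tendsto (fun v : Fin (n + 1) → ℕ => (Fin.cons i v : Fin (n + 2) → ℕ)) _ _)), hy⟩
    exact tendsto_comap

/-- On a compact set, continuous real functions are uniform limits of polynomials with rational
coefficients. -/
theorem exists_mvPolynomial_rat_near {σ : Type*} {K : Set (σ → ℝ)} (hK : IsCompact K)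
    {f : (σ → ℝ) → ℝ} (hf : Continuous f) {ε : ℝ} (hε : 0 < ε) :
    ∃ q : MvPolynomial σ ℚ, ∀ x ∈ K, dist (f x) (MvPolynomial.aeval x q) < ε := by
  have : CompactSpace K := isCompact_iff_compactSpace.1 hK
  let coord : σ → C(K, ℝ) := fun i => ⟨fun x => x.1 i, (continuous_apply i).comp continuous_subtype_val⟩
  let φ : MvPolynomial σ ℚ →ₐ[ℚ] C(K, ℝ) := MvPolynomial.aeval coord
  have hφ (q : MvPolynomial σ ℚ) (x : K) : φ q x = MvPolynomial.aeval x.1 q := by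
    induction q using MvPolynomial.induction_on with
    | C a => simp [φ]
    | add p q hp hq => simp [hp, hq]
    | mul_X p i hp => simp [hp, φ, coord]
  let S : Subsemiring C(K, ℝ) := φ.range.toSubsemiring.topologicalClosure
  let A : Subalgebra ℝ C(K, ℝ) :=
    { S with
      algebraMap_mem' := fun r => by
        have hr : r ∈ closure (Set.range ((↑) : ℚ → ℝ)) := Rat.denseRange_cast r
        have hc : Continuous (algebraMap ℝ C(K, ℝ)) := continuous_algebraMap ℝ C(K, ℝ)
        refine map_mem_closure hc hr ?_
        rintro _ ⟨a, rfl⟩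
        exact ⟨MvPolynomial.C a, by ext x; simp⟩ }
  have hA : A.topologicalClosure = ⊤ := by
    refine ContinuousMap.subalgebra_topologicalClosure_eq_top_of_separatesPoints A ?_
    intro x y hxy
    obtain ⟨i, hi⟩ := Function.ne_iff.1 (Subtype.coe_injective.ne hxy)
    refine ⟨coord i, ⟨coord i, subset_closure ⟨MvPolynomial.X i, ?_⟩, rfl⟩, hi⟩
    simp [φ]
  have hclosed : IsClosed (A : Set C(K, ℝ)) := isClosed_closure
  let g : C(K, ℝ) := ⟨fun x => f x.1, by fun_prop⟩
  have hg : g ∈ closure (φ.range : Set C(K, ℝ)) := by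
    have : g ∈ A.topologicalClosure := hA ▸ Algebra.mem_top
    exact hclosed.closure_subset this
  obtain ⟨_, ⟨q, rfl⟩, hq⟩ := Metric.mem_closure_iff.1 hg ε hε
  refine ⟨q, fun x hx => ?_⟩
  have := (ContinuousMap.dist_lt_iff hε).1 hq ⟨x, hx⟩
  rw [← hφ q ⟨x, hx⟩]
  exact this

/-- Any function f : ℝ^m → ℝ^k admitting an n-tower with continuous sections admits an
n-tower all of whose sections have polynomial coordinates with rational coefficients. -/
theorem tower_of_rational_polynomials (n m k : ℕ) (hn : 1 ≤ n)
    (f : (Fin m → ℝ) → (Fin k → ℝ))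
    (F : (Fin n → ℕ) → (Fin m → ℝ) → (Fin k → ℝ))
    (hFc : ∀ v, Continuous (F v))
    (hFt : ∀ x, IterLimit n (fun v => F v x) (f x)) :
    ∃ G : (Fin n → ℕ) → (Fin m → ℝ) → (Fin k → ℝ),
      (∀ v j, ∃ q : MvPolynomial (Fin m) ℚ, ∀ x, G v x j = MvPolynomial.aeval x q) ∧
      ∀ x, IterLimit n (fun v => G v x) (f x) := by
  obtain ⟨n, rfl⟩ := Nat.exists_eq_add_of_le' hn
  have hq (v : Fin (n + 1) → ℕ) (j : Fin k) : ∃ q : MvPolynomial (Fin m) ℚ,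
      ∀ x ∈ Metric.closedBall (0 : Fin m → ℝ) (v (Fin.last n)),
        dist (F v x j) (MvPolynomial.aeval x q) < 1 / ((v (Fin.last n) : ℝ) + 1) :=
    exists_mvPolynomial_rat_near (isCompact_closedBall _ _)
      ((continuous_apply j).comp (hFc v)) Nat.one_div_pos_of_nat
  choose q hq using hq
  refine ⟨fun v x j => MvPolynomial.aeval x (q v j), fun v j => ⟨q v j, fun x => rfl⟩,
    fun x => (hFt x).congr_dist ?_⟩
  refine squeeze_zero' (Eventually.of_forall fun v => dist_nonneg) ?_
    ((tendsto_one_div_add_atTop_nhds_zero_nat (𝕜 := ℝ)).comp tendsto_comap)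
  have hx : ∀ᶠ N : ℕ in atTop, ‖x‖ ≤ N := tendsto_natCast_atTop_atTop.eventually_ge_atTop _
  filter_upwards [tendsto_comap.eventually hx] with v hv
  exact (dist_pi_le_iff Nat.one_div_pos_of_nat.le).2 fun j =>
    (hq v j x (mem_closedBall_zero_iff.2 hv)).le
end

section
/- Let d ≥ 1 and let V ⊆ ℝ^d be a real algebraic set whose vanishing ideal I(V) ⊆ ℝ[X₁,…,X_d] is a prime ideal (in particular V ≠ ∅). Let (W_k)_{k∈ℕ} be a sequence of real algebraic subsets of ℝ^d such that V ⊄ W_k for every k. Then there exists a point x ∈ V with x ∉ W_k for all k ∈ ℕ. -/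
open MvPolynomial

/-- The real algebraic set determined by a set S of polynomials. -/
noncomputable def zeroSet {d : ℕ} (S : Set (MvPolynomial (Fin d) ℝ)) : Set (Fin d → ℝ) :=
  {x | ∀ f ∈ S, aeval x f = 0}

/-- The vanishing ideal I(V) of a subset V ⊆ ℝ^d. -/
noncomputable def realVanishingIdeal {d : ℕ} (V : Set (Fin d → ℝ)) : Ideal (MvPolynomial (Fin d) ℝ) where
  carrier := {f | ∀ x ∈ V, aeval x f = 0}
  add_mem' := by
    intro f g hf hg x hx
    simp [map_add, hf x hx, hg x hx]
  zero_mem' := by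
    intro x hx
    simp
  smul_mem' := by
    intro c f hf x hx
    simp [smul_eq_mul, map_mul, hf x hx]

theorem Polynomial.exists_eval_neg_and_pos_of_simple_root {p : Polynomial ℝ} {y : ℝ}
    (h0 : p.eval y = 0) (h1 : p.derivative.eval y ≠ 0) :
    ∃ a b, p.eval a < 0 ∧ 0 < p.eval b := by
  by_contra! H
  refine h1 ?_
  by_cases ha : ∃ a, p.eval a < 0
  · obtain ⟨a, ha⟩ := ha
    exact IsLocalMax.hasDerivAt_eq_zero
      (Filter.Eventually.of_forall fun b ↦ by simpa [h0] using H a b ha) (p.hasDerivAt y)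
  · push Not at ha
    exact IsLocalMin.hasDerivAt_eq_zero
      (Filter.Eventually.of_forall fun b ↦ by simpa [h0] using ha b) (p.hasDerivAt y)

theorem MvPolynomial.dense_aeval_ne_zero {k σ : Type*} [Finite σ] [Field k] [Algebra k ℝ]
    {p : MvPolynomial σ k} (hp : p ≠ 0) : Dense {x : σ → ℝ | aeval x p ≠ 0} := by
  have := Fintype.ofFinite σ
  rw [← Set.compl_ofPred, ← interior_eq_empty_iff_dense_compl, Set.eq_empty_iff_forall_notMem]
  intro x hx
  rw [mem_interior_iff_mem_nhds, Metric.mem_nhds_iff] at hx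
  obtain ⟨ε, hε, hx⟩ := hx
  apply (map_ne_zero_iff (MvPolynomial.map (σ := σ) (algebraMap k ℝ))
    (map_injective _ (algebraMap k ℝ).injective)).2 hp
  apply MvPolynomial.funext_set (fun i ↦ Metric.ball (x i) ε)
  · intro i
    rw [Real.ball_eq_Ioo]
    exact Set.Ioo_infinite (by linarith)
  · intro z hz
    rw [← ball_pi _ hε] at hz
    simpa [eval_map, aeval_def] using hx hz

theorem MvPolynomial.continuous_aeval_real {k σ : Type*} [CommSemiring k] [Algebra k ℝ]
    (p : MvPolynomial σ k) : Continuous fun x : σ → ℝ ↦ aeval x p := by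
  simp only [aeval_def, ← eval_map]
  exact MvPolynomial.continuous_eval _

theorem exists_algebraicIndependent_mem_of_isOpen {k σ : Type*} [Finite σ] [Field k] [Countable k]
    [Algebra k ℝ] {U : Set (σ → ℝ)} (hU : IsOpen U) (hne : U.Nonempty) :
    ∃ τ ∈ U, AlgebraicIndependent k τ := by
  have : Countable (MvPolynomial σ k) := (basisMonomials σ k).repr.injective.countable
  have hd : Dense (⋂ p : {p : MvPolynomial σ k // p ≠ 0}, {x : σ → ℝ | aeval x p.1 ≠ 0}) := by
    refine dense_iInter_of_isOpen (fun p ↦ ?_) fun p ↦ dense_aeval_ne_zero p.2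
    exact isOpen_ne_fun (continuous_aeval_real p.1) continuous_const
  obtain ⟨τ, hτU, hτ⟩ := hd.inter_open_nonempty U hU hne
  refine ⟨τ, hτU, (injective_iff_map_eq_zero _).2 fun p hp ↦ ?_⟩
  by_contra hp0
  exact Set.mem_iInter.1 hτ ⟨p, hp0⟩ hp

/-- A simple real root of a polynomial family persists at some parameter that is generic over a
countable field of definition. -/
theorem exists_algebraicIndependent_root {k σ : Type*} [Finite σ] [Field k] [Countable k]
    [Algebra k ℝ] (m : Polynomial (MvPolynomial σ k)) {τ₀ : σ → ℝ} {y₀ : ℝ}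
    (h0 : (m.map (aeval (R := k) τ₀).toRingHom).eval y₀ = 0)
    (h1 : (m.map (aeval (R := k) τ₀).toRingHom).derivative.eval y₀ ≠ 0) :
    ∃ τ : σ → ℝ, AlgebraicIndependent k τ ∧
      ∃ y, (m.map (aeval (R := k) τ).toRingHom).eval y = 0 := by
  obtain ⟨a, b, ha, hb⟩ := Polynomial.exists_eval_neg_and_pos_of_simple_root h0 h1
  have hc (y : ℝ) : Continuous fun τ : σ → ℝ ↦ (m.map (aeval (R := k) τ).toRingHom).eval y := by
    simp only [Polynomial.eval_map, Polynomial.eval₂_eq_sum, Polynomial.sum]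
    exact continuous_finsetSum _ fun i _ ↦ (continuous_aeval_real _).mul continuous_const
  obtain ⟨τ, ⟨hτa, hτb⟩, hτ⟩ := exists_algebraicIndependent_mem_of_isOpen (k := k)
    ((isOpen_lt (hc a) continuous_const).inter (isOpen_lt continuous_const (hc b)))
    ⟨τ₀, ha, hb⟩
  exact ⟨τ, hτ, mem_range_of_exists_le_of_exists_ge (Polynomial.continuous _)
    ⟨a, le_of_lt hτa⟩ ⟨b, le_of_lt hτb⟩⟩

/-- A primitive element of an algebraic extension of fraction fields can be taken in the ring. -/
theorem exists_primitive_element_algebraMap (B C F K : Type*) [CommRing B] [IsDomain B]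
    [CommRing C] [IsDomain C] [Algebra B C] [FaithfulSMul B C] [Algebra.IsAlgebraic B C]
    [Field F] [Algebra B F] [IsFractionRing B F] [Field K] [Algebra C K] [IsFractionRing C K]
    [Algebra F K] [Algebra B K] [IsScalarTower B C K] [IsScalarTower B F K]
    [FiniteDimensional F K] [Algebra.IsSeparable F K] :
    ∃ c : C, IntermediateField.adjoin F {algebraMap C K c} = ⊤ := by
  obtain ⟨α, hα⟩ := Field.exists_primitive_element F K
  obtain ⟨a, b, hb, rfl⟩ := IsFractionRing.div_surjective (A := C) α
  obtain ⟨c, d, hd, h⟩ := Algebra.IsAlgebraic.exists_smul_eq_mul B a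
    (nonZeroDivisors.ne_zero hb)
  refine ⟨c, ?_⟩
  rw [← top_le_iff, ← hα, IntermediateField.adjoin_simple_le_iff]
  have hb' : algebraMap C K b ≠ 0 := by
    simpa using nonZeroDivisors.ne_zero hb
  have hd' : algebraMap F K (algebraMap B F d) ≠ 0 := by simpa using hd
  have h' : algebraMap F K (algebraMap B F d) * algebraMap C K a =
      algebraMap C K b * algebraMap C K c := by
    rw [← map_mul, ← h, Algebra.smul_def, map_mul, ← IsScalarTower.algebraMap_apply,
      ← IsScalarTower.algebraMap_apply]
  have : algebraMap C K a / algebraMap C K b =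
      algebraMap C K c / algebraMap F K (algebraMap B F d) := by
    rw [div_eq_div_iff hb' hd']
    linear_combination h'
  rw [this]
  exact div_mem (IntermediateField.mem_adjoin_simple_self F _)
    (IntermediateField.algebraMap_mem _ _)

/-- A domain of finite type over a countable subfield of `ℝ` whose real points are
schematically dense embeds into `ℝ`. -/
theorem exists_injective_algHom_real {k C : Type*} [Field k] [Countable k] [Algebra k ℝ]
    [CommRing C] [IsDomain C] [Algebra k C] [Algebra.FiniteType k C]
    (H : ∀ c : C, c ≠ 0 → ∃ φ : C →ₐ[k] ℝ, φ c ≠ 0) :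
    ∃ φ : C →ₐ[k] ℝ, Function.Injective φ := by
  have : CharZero k := (algebraMap k ℝ).charZero
  obtain ⟨G, hG⟩ := Algebra.FiniteType.out (R := k) (A := C)
  have : Algebra.IsAlgebraic (Algebra.adjoin k (G : Set C)) C := by
    rw [hG]
    exact ⟨fun c ↦ isAlgebraic_algebraMap (⟨c, trivial⟩ : (⊤ : Subalgebra k C))⟩
  obtain ⟨s, hsG, hs⟩ := exists_isTranscendenceBasis_subset (R := k) (G : Set C)
  have : Finite s := (G.finite_toSet.subset hsG).to_subtype
  let B := MvPolynomial s k
  let : Algebra B C := (aeval (R := k) ((↑) : s → C)).toAlgebra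
  have : IsScalarTower k B C :=
    .of_algebraMap_eq' (aeval (R := k) ((↑) : s → C)).comp_algebraMap.symm
  have : FaithfulSMul B C := (faithfulSMul_iff_algebraMap_injective _ _).2 hs.1
  have : Algebra.IsAlgebraic B C := by
    have := hs.isAlgebraic
    exact .of_ringHom_of_comp_eq hs.1.aevalEquiv.toRingHom (RingHom.id C)
      hs.1.aevalEquiv.surjective Function.injective_id rfl
  let F := FractionRing B
  let K := FractionRing C
  let : Algebra F K := FractionRing.liftAlgebra B K
  have : IsScalarTower B F K := FractionRing.isScalarTower_liftAlgebra B K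
  have : IsScalarTower k F K := .to₁₃₄ k B F K
  have : Algebra.IsAlgebraic C K := (IsFractionRing.comap_isAlgebraic_iff (K := K)).2 inferInstance
  have : Algebra.IsAlgebraic B K := .trans B C K
  have : Algebra.IsAlgebraic F K := (IsFractionRing.comap_isAlgebraic_iff (A := B)).1 ‹_›
  have : Algebra.EssFiniteType k K := .comp k C K
  have : Algebra.EssFiniteType F K := .of_comp k F K
  have : FiniteDimensional F K := Algebra.finite_of_essFiniteType_of_isAlgebraic
  have : CharZero F := charZero_of_injective_algebraMap (algebraMap k F).injective
  obtain ⟨c, hc⟩ := exists_primitive_element_algebraMap B C F K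
  have hint : IsIntegral F (algebraMap C K c) := Algebra.IsIntegral.isIntegral _
  obtain ⟨b, hb, hm⟩ := IsLocalization.integerNormalization_spec (nonZeroDivisors B)
    (minpoly F (algebraMap C K c))
  rw [← algebraMap_smul F b] at hm
  set m := IsLocalization.integerNormalization (nonZeroDivisors B) (minpoly F (algebraMap C K c))
  have hb0 : algebraMap B F b ≠ 0 := by simpa using nonZeroDivisors.ne_zero hb
  have key (p : Polynomial B) : algebraMap C K (Polynomial.aeval c p) =
      Polynomial.aeval (algebraMap C K c) (p.map (algebraMap B F)) := by
    rw [Polynomial.aeval_map_algebraMap, Polynomial.aeval_algebraMap_apply]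
  have hm0 : Polynomial.aeval c m = 0 := by
    apply IsFractionRing.injective C K
    rw [key, hm, map_smul, minpoly.aeval, smul_zero, map_zero]
  have hm1 : Polynomial.aeval c m.derivative ≠ 0 := by
    intro h
    apply_fun algebraMap C K at h
    rw [key, ← Polynomial.derivative_map, hm, Polynomial.derivative_smul, map_smul, map_zero,
      smul_eq_zero_iff_right hb0] at h
    exact (Algebra.IsSeparable.isSeparable F (algebraMap C K c)).aeval_derivative_ne_zero
      (minpoly.aeval _ _) h
  obtain ⟨φ, hφ⟩ := H _ hm1
  have hφ' (p : Polynomial B) :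
      (p.map (aeval (R := k) fun i : s ↦ φ i).toRingHom).eval (φ c) = φ (Polynomial.aeval c p) := by
    rw [Polynomial.eval_map, Polynomial.aeval_def, ← AlgHom.coe_toRingHom φ, Polynomial.hom_eval₂]
    congr 1
    refine RingHom.ext fun q ↦ ?_
    change aeval (fun i : s ↦ φ i) q = φ (aeval (fun i : s ↦ (i : C)) q)
    rw [comp_aeval_apply]
  obtain ⟨τ, hτ, y, hy⟩ := exists_algebraicIndependent_root m (τ₀ := fun i : s ↦ φ i) (y₀ := φ c)
    (by rw [hφ', hm0, map_zero]) (by rwa [Polynomial.derivative_map, hφ'])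
  let : Algebra B ℝ := (aeval (R := k) τ).toAlgebra
  have : IsScalarTower k B ℝ := .of_algebraMap_eq' (aeval (R := k) τ).comp_algebraMap.symm
  have : FaithfulSMul B ℝ := (faithfulSMul_iff_algebraMap_injective _ _).2 hτ
  let : Algebra F ℝ := FractionRing.liftAlgebra B ℝ
  have : IsScalarTower B F ℝ := FractionRing.isScalarTower_liftAlgebra B ℝ
  have : IsScalarTower k F ℝ := .to₁₃₄ k B F ℝ
  have hy' : Polynomial.aeval y (minpoly F (algebraMap C K c)) = 0 := by
    have : Polynomial.aeval y (m.map (algebraMap B F)) = 0 := by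
      rw [Polynomial.aeval_map_algebraMap, Polynomial.aeval_def, ← Polynomial.eval_map]
      exact hy
    rw [hm, map_smul] at this
    exact (smul_eq_zero_iff_right hb0).1 this
  let g : K →ₐ[F] ℝ := ((IntermediateField.algHomAdjoinIntegralEquiv F hint).symm
    ⟨y, (Polynomial.mem_aroots.2 ⟨minpoly.ne_zero hint, hy'⟩)⟩).comp
    ((IntermediateField.equivOfEq hc).trans IntermediateField.topEquiv).symm.toAlgHom
  exact ⟨(g.restrictScalars k).comp (IsScalarTower.toAlgHom k C K),
    g.injective.comp (IsFractionRing.injective C K)⟩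

/-- Countably many real polynomials have coefficients in a common countable subfield. -/
theorem exists_countable_subfield_subset_range_map {σ : Type*} {T : Set (MvPolynomial σ ℝ)}
    (hT : T.Countable) : ∃ k : Subfield ℝ, Countable k ∧
      T ⊆ Set.range (MvPolynomial.map (σ := σ) (algebraMap k ℝ)) := by
  let c : Set ℝ := ⋃ f ∈ T, (f.coeffs : Set ℝ)
  have hc : c.Countable := hT.biUnion fun f _ ↦ f.coeffs.countable_toSet
  refine ⟨Subfield.closure c, ?_, fun f hf ↦ mem_range_map_iff_coeffs_subset.2 fun a ha ↦ ?_⟩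
  · rw [← Cardinal.mk_le_aleph0_iff]
    exact (Subfield.cardinalMk_closure_le_max c).trans
      (max_le (Cardinal.le_aleph0_iff_set_countable.2 hc) le_rfl)
  · exact ⟨⟨a, Subfield.subset_closure (Set.mem_biUnion hf ha)⟩, rfl⟩

theorem mem_zeroSet_of_vanishing {d : ℕ} {S G : Set (MvPolynomial (Fin d) ℝ)}
    (hG : Ideal.span G = realVanishingIdeal (zeroSet S)) {x : Fin d → ℝ}
    (hx : ∀ g ∈ G, aeval x g = 0) : x ∈ zeroSet S := by
  have hle : Ideal.span G ≤ RingHom.ker (aeval (R := ℝ) x) := Ideal.span_le.2 hx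
  exact fun f hf ↦ hle (hG ▸ fun y hy ↦ hy f hf)


/-- An irreducible real algebraic set (one whose vanishing ideal is prime) cannot be covered
by countably many real algebraic sets none of which contains it. -/
theorem irreducible_not_covered_by_countably_many_algebraic (d : ℕ) (hd : 1 ≤ d)
    (V : Set (Fin d → ℝ)) (hV : ∃ S, V = zeroSet S)
    (hprime : (realVanishingIdeal V).IsPrime)
    (W : ℕ → Set (Fin d → ℝ)) (hW : ∀ k, ∃ S, W k = zeroSet S)
    (hnc : ∀ k, ¬ V ⊆ W k) :
    ∃ x ∈ V, ∀ k, x ∉ W k := by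
  obtain ⟨S, rfl⟩ := hV
  have hf (n : ℕ) : ∃ f ∉ realVanishingIdeal (zeroSet S), ∀ x ∈ W n, aeval x f = 0 := by
    obtain ⟨S', hS'⟩ := hW n
    obtain ⟨x, hxV, hxW⟩ := Set.not_subset.1 (hnc n)
    rw [hS'] at hxW ⊢
    obtain ⟨f, hf, hfx⟩ : ∃ f ∈ S', aeval x f ≠ 0 := by simpa [zeroSet] using hxW
    exact ⟨f, fun h ↦ hfx (h x hxV), fun z hz ↦ hz f hf⟩
  choose f hfP hfW using hf
  obtain ⟨G, hG⟩ := (inferInstance :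
    IsNoetherianRing (MvPolynomial (Fin d) ℝ)).noetherian (realVanishingIdeal (zeroSet S))
  obtain ⟨k, hk, hT⟩ := exists_countable_subfield_subset_range_map
    (G.countable_toSet.union (Set.countable_range f))
  let Q := (realVanishingIdeal (zeroSet S)).comap (MvPolynomial.map (algebraMap k ℝ))
  have hQ : Q.IsPrime := Ideal.comap_isPrime _ _
  have hQ0 (x) (hx : x ∈ zeroSet S) (p) (hp : p ∈ Q) : aeval x p = 0 := by
    rw [← aeval_map_algebraMap ℝ]
    exact hp x hx
  obtain ⟨φ, hφ⟩ := exists_injective_algHom_real (k := k) (C := MvPolynomial (Fin d) k ⧸ Q) <| by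
    intro c hc
    obtain ⟨p, rfl⟩ := Ideal.Quotient.mk_surjective c
    rw [Ne, Ideal.Quotient.eq_zero_iff_mem] at hc
    obtain ⟨x, hx, hpx⟩ : ∃ x ∈ zeroSet S, aeval x (MvPolynomial.map (algebraMap k ℝ) p) ≠ 0 := by
      by_contra! h
      exact hc h
    refine ⟨Ideal.Quotient.liftₐ Q (aeval x) (hQ0 x hx), ?_⟩
    rwa [aeval_map_algebraMap] at hpx
  let x : Fin d → ℝ := fun i ↦ φ (Ideal.Quotient.mk Q (X i))
  have hx (p : MvPolynomial (Fin d) k) :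
      aeval x (MvPolynomial.map (algebraMap k ℝ) p) = 0 ↔
        MvPolynomial.map (algebraMap k ℝ) p ∈ realVanishingIdeal (zeroSet S) := by
    have : aeval x = φ.comp (Ideal.Quotient.mkₐ k Q) := by
      ext i
      simp [x]
    rw [aeval_map_algebraMap, this, ← Ideal.mem_comap, ← Ideal.Quotient.eq_zero_iff_mem]
    exact map_eq_zero_iff φ hφ
  refine ⟨x, mem_zeroSet_of_vanishing hG fun g hg ↦ ?_, fun n hn ↦ ?_⟩
  · obtain ⟨p, rfl⟩ := hT (Or.inl hg)
    exact (hx p).2 (hG ▸ Ideal.subset_span hg)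
  · obtain ⟨p, hp⟩ := hT (Or.inr ⟨n, rfl⟩)
    exact hfP n (hp ▸ (hx p).1 (hp ▸ hfW n x hn))
end
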